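/- Let p be a prime and let G be a transitive permutation group on a set of p elements. Then G is doubly transitive or G is solvable. -/

import Mathlib

open Polynomial in
/-- If the power sums of exponents `1, …, r - 1` over `U` vanish, then summing a polynomial of
degree at most `r` over `U` only sees its constant and its `r`-th coefficient. -/
lemma sum_eval_sub_eval_zero {F : Type*} [Field F] (U : Finset F) {r : ℕ} (hr : 1 ≤ r)
    (hS : ∀ k, 1 ≤ k → k < r → ∑ u ∈ U, u ^ k = 0) (f : F[X]) (hf : f.natDegree ≤ r) :
    ∑ u ∈ U, (f.eval u - f.eval 0) = f.coeff r * ∑ u ∈ U, u ^ r := by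
  have h : ∀ u, f.eval u - f.eval 0 = ∑ k ∈ Finset.Icc 1 r, f.coeff k * u ^ k := by
    intro u
    rw [eval_eq_sum_range' (Nat.lt_succ_of_le hf), Finset.sum_range_succ',
      ← coeff_zero_eq_eval_zero, Finset.sum_bij (fun k _ => k + 1) (t := Finset.Icc 1 r)
        (g := fun k => f.coeff k * u ^ k)]
    · simp
    · intro a ha
      simp only [Finset.mem_range, Finset.mem_Icc] at ha ⊢
      omega
    · intro a _ b _ hab
      simpa using hab
    · intro b hb
      rw [Finset.mem_Icc] at hb
      exact ⟨b - 1, by rw [Finset.mem_range]; omega, by omega⟩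
    · intros; rfl
  simp_rw [h]
  rw [Finset.sum_comm, Finset.sum_eq_single_of_mem r (by simp [hr])]
  · rw [Finset.mul_sum]
  · intro k hk hkr
    rw [Finset.mem_Icc] at hk
    rw [← Finset.mul_sum, hS k hk.1 (by omega), mul_zero]

open Polynomial in
/-- A nonempty finite set of nonzero field elements has a nonzero power sum of exponent at most
its cardinality. -/
lemma exists_sum_pow_ne_zero {F : Type*} [Field F] (U : Finset F) (h0 : (0 : F) ∉ U)
    (hU : U.Nonempty) : ∃ r, 1 ≤ r ∧ r ≤ U.card ∧ ∑ u ∈ U, u ^ r ≠ 0 := by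
  classical
  by_contra! H
  obtain ⟨v, hv⟩ := hU
  have hcard : 1 ≤ U.card := Finset.card_pos.2 ⟨v, hv⟩
  have hdeg : (X * ∏ w ∈ U.erase v, (X - C w)).natDegree ≤ U.card := by
    refine natDegree_mul_le.trans ?_
    rw [natDegree_prod_of_monic _ _ fun w _ => monic_X_sub_C w]
    simp only [natDegree_X, natDegree_X_sub_C, Finset.sum_const, smul_eq_mul, mul_one,
      Finset.card_erase_of_mem hv]
    omega
  have h := sum_eval_sub_eval_zero U hcard (fun k hk hk' => H k hk hk'.le) _ hdeg
  rw [H _ hcard le_rfl, mul_zero, Finset.sum_eq_single_of_mem v hv] at h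
  · have hne : v ≠ 0 := fun h => h0 (h ▸ hv)
    simp only [eval_mul, eval_X, eval_prod, eval_sub, eval_C, zero_mul, sub_zero, mul_eq_zero, hne,
      false_or, Finset.prod_eq_zero_iff, Finset.mem_erase, sub_eq_zero] at h
    obtain ⟨w, hw, hw'⟩ := h
    exact hw.1 hw'.symm
  · intro w hw hwv
    have : ∏ z ∈ U.erase v, (w - z) = 0 :=
      Finset.prod_eq_zero (Finset.mem_erase.2 ⟨hwv, hw⟩) (sub_self w)
    simp [eval_prod, this]

open Polynomial in
/-- If `Q` has degree `d` with `r ≤ d < p`, where `r` is the least positive exponent of a nonzero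
power sum of `U`, and the difference operator attached to `U` sends `Q` to a constant function `c`,
then `d = r` and `c ≠ 0`. -/
lemma natDegree_eq_of_sum_sub_eq_const {p : ℕ} [Fact p.Prime] (U : Finset (ZMod p)) {r : ℕ}
    (hr : 1 ≤ r) (hS : ∀ k, 1 ≤ k → k < r → ∑ u ∈ U, u ^ k = 0) (hSr : ∑ u ∈ U, u ^ r ≠ 0)
    (Q : (ZMod p)[X]) (hrd : r ≤ Q.natDegree) (hd : Q.natDegree < p) (c : ZMod p)
    (hc : ∀ x, ∑ u ∈ U, (Q.eval (x + u) - Q.eval x) = c) : Q.natDegree = r ∧ c ≠ 0 := by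
  have hcoeff : (∑ u ∈ U, (taylor u Q - Q)).coeff (Q.natDegree - r) ≠ 0 := by
    have hf : (hasseDeriv (Q.natDegree - r) Q).natDegree ≤ r := by
      refine (natDegree_hasseDeriv_le _ _).trans ?_
      omega
    have h := sum_eval_sub_eval_zero U hr hS _ hf
    rw [← coeff_zero_eq_eval_zero, hasseDeriv_coeff, hasseDeriv_coeff] at h
    simp only [zero_add, Nat.choose_self, Nat.cast_one, one_mul,
      Nat.add_sub_of_le hrd] at h
    simp only [finsetSum_coeff, coeff_sub, taylor_coeff, h]
    have hQ : Q ≠ 0 := by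
      rintro rfl
      simp at hrd
      omega
    refine mul_ne_zero (mul_ne_zero ?_ (leadingCoeff_ne_zero.2 hQ)) hSr
    rw [Ne, ZMod.natCast_eq_zero_iff]
    intro hdvd
    have := ((Fact.out : p.Prime).dvd_factorial).1
      (hdvd.trans (Nat.choose_mul_factorial_mul_factorial (Nat.sub_le Q.natDegree r) ▸
        (Dvd.intro _ (mul_assoc _ _ _).symm)))
    omega
  have hconst : (∑ u ∈ U, (taylor u Q - Q)) = C c := by
    refine eq_of_natDegree_lt_card_of_eval_eq _ _ Function.injective_id ?_ ?_
    · intro x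
      simp [eval_finsetSum, taylor_eval, ← hc x]
    · rw [ZMod.card, natDegree_C, max_lt_iff]
      refine ⟨lt_of_le_of_lt (natDegree_sum_le_of_forall_le (n := Q.natDegree) _ _ fun u _ => ?_) hd,
        (Fact.out : p.Prime).pos⟩
      exact (natDegree_sub_le _ _).trans (by simp)
  rw [hconst, coeff_C] at hcoeff
  split_ifs at hcoeff with h
  · exact ⟨by omega, hcoeff⟩
  · exact absurd rfl hcoeff

/-- Averaging over the neighbours in the Cayley graph of `U` commutes with its automorphisms. -/
lemma sum_perm_add {A M : Type*} [AddCommGroup A] [AddCommMonoid M] (U : Finset A)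
    (π : Equiv.Perm A) (hπ : ∀ i j, i - j ∈ U ↔ π i - π j ∈ U) (f : A → M) (x : A) :
    ∑ u ∈ U, f (π (x + u)) = ∑ u ∈ U, f (π x + u) := by
  refine Finset.sum_nbij' (fun u => π (x + u) - π x) (fun v => π.symm (π x + v) - x) ?_ ?_ ?_ ?_ ?_
  · intro u hu
    rw [← hπ]
    simpa using hu
  · intro u hu
    rw [hπ]
    simpa using hu
  all_goals
    intro u hu
    simp

open Polynomial in
/-- A permutation of `ZMod p` preserving the Cayley graph of a small nonempty set `U` of nonzero
elements is affine. -/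
lemma affine_of_preserves_of_card_lt {p : ℕ} [Fact p.Prime] (U : Finset (ZMod p))
    (h0 : (0 : ZMod p) ∉ U) (hU : U.Nonempty) (hcard : 2 * U.card ≤ p) (π : Equiv.Perm (ZMod p))
    (hπ : ∀ i j, i - j ∈ U ↔ π i - π j ∈ U) : ∃ a b, ∀ x, π x = a * x + b := by
  classical
  have hex := exists_sum_pow_ne_zero U h0 hU
  obtain ⟨hr, hrU, hSr⟩ := Nat.find_spec hex
  have hmin := fun k => Nat.find_min hex (m := k)
  set r := Nat.find hex
  have hS : ∀ k, 1 ≤ k → k < r → ∑ u ∈ U, u ^ k = 0 := by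
    intro k hk hkr
    by_contra hne
    exact hmin k hkr ⟨hk, by omega, hne⟩
  set P : (ZMod p)[X] := Lagrange.interpolate Finset.univ id π
  have hP : ∀ x, P.eval x = π x := fun x =>
    Lagrange.eval_interpolate_at_node π Function.injective_id.injOn (Finset.mem_univ x)
  have hn : P.natDegree < p := by
    by_cases hP0 : P = 0
    · simpa [hP0] using (Fact.out : p.Prime).pos
    · rw [natDegree_lt_iff_degree_lt hP0]
      have := Lagrange.degree_interpolate_lt (s := Finset.univ) (v := id) π
        Function.injective_id.injOn
      rwa [Finset.card_univ, ZMod.card] at this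
  have hcomm : ∀ j x, ∑ u ∈ U, ((P ^ j).eval (x + u) - (P ^ j).eval x)
      = ∑ u ∈ U, ((π x + u) ^ j - π x ^ j) := by
    intro j x
    simp only [eval_pow, hP, Finset.sum_sub_distrib]
    rw [sum_perm_add U π hπ fun y => y ^ j]
  rcases Nat.lt_or_ge 1 P.natDegree with h1 | h1
  · exfalso
    rcases Nat.lt_or_ge P.natDegree r with hlt | hge
    · have hex' : ∃ j, r ≤ j * P.natDegree := ⟨r, by nlinarith⟩
      have hj := Nat.find_spec hex'
      have hjmin := fun k => Nat.find_min hex' (m := k)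
      set j := Nat.find hex'
      have hj0 : j ≠ 0 := by
        intro h
        rw [h] at hj
        omega
      have hj' := hjmin (j - 1) (by omega)
      obtain ⟨i, hi⟩ := Nat.exists_eq_succ_of_ne_zero hj0
      rw [hi] at hj hj'
      simp only [Nat.succ_sub_one, Nat.succ_eq_add_one, add_mul, one_mul, not_le] at hj hj'
      have hjr : j < r := by
        by_contra! hjr
        have : r ≤ i + 1 := by omega
        nlinarith
      have hdeg : (P ^ j).natDegree = i * P.natDegree + P.natDegree := by
        rw [natDegree_pow, hi, Nat.succ_mul]
      refine (natDegree_eq_of_sum_sub_eq_const U hr hS hSr (P ^ j) (by omega) (by omega) 0 ?_).2 rfl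
      intro x
      rw [hcomm]
      have hd : ((X + C (π x)) ^ j).natDegree = j := by simp
      have := sum_eval_sub_eval_zero U hr hS ((X + C (π x)) ^ j) (by omega)
      rw [coeff_eq_zero_of_natDegree_lt (by omega), zero_mul] at this
      simpa [add_comm] using this
    · obtain ⟨hnr, hc⟩ := natDegree_eq_of_sum_sub_eq_const U hr hS hSr P hge hn (∑ u ∈ U, u) <| by
        intro x
        simpa using hcomm 1 x
      have := hS 1 le_rfl (by omega)
      simp only [pow_one] at this
      exact hc this
  · obtain ⟨a, b, hab⟩ := exists_eq_X_add_C_of_natDegree_le_one h1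
    refine ⟨a, b, fun x => ?_⟩
    rw [← hP, hab]
    simp

/-- A permutation of `ZMod p` preserving the Cayley graph of a nonempty proper subset of the
nonzero elements is affine. -/
lemma affine_of_preserves {p : ℕ} [Fact p.Prime] (U : Finset (ZMod p)) (h0 : (0 : ZMod p) ∉ U)
    (hU : U.Nonempty) (hU' : ∃ v, v ≠ 0 ∧ v ∉ U) (π : Equiv.Perm (ZMod p))
    (hπ : ∀ i j, i - j ∈ U ↔ π i - π j ∈ U) : ∃ a b, ∀ x, π x = a * x + b := by
  classical
  rcases Nat.lt_or_ge p (2 * U.card) with h | h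
  · obtain ⟨v, hv, hvU⟩ := hU'
    refine affine_of_preserves_of_card_lt (Uᶜ.erase 0) (by simp) ⟨v, by simp [hv, hvU]⟩ ?_ π ?_
    · rw [Finset.card_erase_of_mem (by simpa using h0), Finset.card_compl, ZMod.card]
      omega
    · intro i j
      simp [sub_eq_zero, hπ i j]
  · exact affine_of_preserves_of_card_lt U h0 hU h π hπ

/-- A permutation of order `p` of a set of prime cardinality `p` is conjugate to `n ↦ n + 1` on
`ZMod p`. -/
lemma exists_equiv_zmod_of_orderOf {p : ℕ} [Fact p.Prime] {X : Type*} [Fintype X]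
    (hX : Fintype.card X = p) (σ : Equiv.Perm X) (hσ : orderOf σ = p) :
    ∃ e : ZMod p ≃ X, ∀ n k, e (n + k) = (σ ^ k.val) (e n) := by
  classical
  have hp : p.Prime := Fact.out
  have hcyc : σ.IsCycle := Equiv.Perm.isCycle_of_prime_order'' (hX ▸ hp) (hσ.trans hX.symm)
  have hsupp : σ.support = Finset.univ := by
    rw [← Finset.card_eq_iff_eq_univ, ← hcyc.orderOf, hσ, hX]
  obtain ⟨x₀⟩ : Nonempty X := Fintype.card_pos_iff.1 (hX ▸ hp.pos)
  have hmoved : ∀ x, σ x ≠ x := fun x => by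
    rw [← Equiv.Perm.mem_support, hsupp]
    exact Finset.mem_univ x
  have hsurj : Function.Surjective fun n : ZMod p => (σ ^ n.val) x₀ := by
    intro y
    obtain ⟨i, hi⟩ := hcyc.exists_pow_eq (hmoved x₀) (hmoved y)
    exact ⟨(i : ZMod p), by simp only [ZMod.val_natCast, ← hi]; rw [← hσ, pow_mod_orderOf]⟩
  have hbij := (Fintype.bijective_iff_surjective_and_card _).2 ⟨hsurj, by rw [ZMod.card, hX]⟩
  refine ⟨Equiv.ofBijective _ hbij, fun n k => ?_⟩
  simp only [Equiv.ofBijective_apply, ZMod.val_add]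
  rw [← Equiv.Perm.mul_apply, ← pow_add, add_comm k.val]
  nth_rw 2 [← pow_mod_orderOf]
  rw [hσ]

/-- A group of permutations acting by affine maps of a commutative ring is solvable. -/
lemma isSolvable_of_forall_affine {R X : Type*} [CommRing R] (e : R ≃ X)
    (G : Subgroup (Equiv.Perm X)) (h : ∀ g ∈ G, ∃ a b, ∀ x, g (e x) = e (a * x + b)) :
    Group.IsSolvable G := by
  let T : Subgroup G :=
    { carrier := {g | ∃ c, ∀ x, (g : Equiv.Perm X) (e x) = e (x + c)}
      one_mem' := ⟨0, by simp⟩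
      mul_mem' := by
        rintro g k ⟨c, hc⟩ ⟨d, hd⟩
        exact ⟨d + c, fun x => by simp [hc, hd, add_assoc]⟩
      inv_mem' := by
        rintro g ⟨c, hc⟩
        exact ⟨-c, fun x => by
          rw [Subgroup.coe_inv, Equiv.Perm.inv_eq_iff_eq, hc, neg_add_cancel_right]⟩ }
  have hT : ⁅(⊤ : Subgroup G), ⊤⁆ ≤ T := by
    rw [Subgroup.commutator_le]
    rintro ⟨g, hg⟩ - ⟨k, hk⟩ -
    obtain ⟨a, b, hab⟩ := h g hg
    obtain ⟨c, d, hcd⟩ := h k hk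
    obtain ⟨a', b', hab'⟩ := h _ (G.inv_mem hg)
    obtain ⟨c', d', hcd'⟩ := h _ (G.inv_mem hk)
    have ha : ∀ x, a * (a' * x + b') + b = x := fun x => by
      rw [← e.apply_eq_iff_eq, ← hab, ← hab']
      simp
    have hc : ∀ x, c * (c' * x + d') + d = x := fun x => by
      rw [← e.apply_eq_iff_eq, ← hcd, ← hcd']
      simp
    have haa : a * a' = 1 := by linear_combination ha 1 - ha 0
    have hcc : c * c' = 1 := by linear_combination hc 1 - hc 0
    refine ⟨a * (c * (a' * d' + b') + d) + b, fun x => ?_⟩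
    simp only [commutatorElement_def, Subgroup.coe_mul, Subgroup.coe_inv, Equiv.Perm.mul_apply,
      hab, hcd, hab', hcd']
    congr 1
    linear_combination (x * c * c') * haa + x * hcc
  have hTT : ⁅T, T⁆ ≤ ⊥ := by
    rw [Subgroup.commutator_le]
    rintro g ⟨c, hc⟩ k ⟨d, hd⟩
    rw [Subgroup.mem_bot, commutatorElement_eq_one_iff_mul_comm]
    ext x
    obtain ⟨x, rfl⟩ := e.surjective x
    simp only [Subgroup.coe_mul, Equiv.Perm.mul_apply, hc, hd]
    rw [add_right_comm]
  refine ⟨2, le_bot_iff.1 (le_trans ?_ hTT)⟩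
  exact Subgroup.commutator_mono hT hT


/-- Burnside: a transitive permutation group of prime degree is doubly
transitive or solvable. -/
theorem burnside_prime_degree (p : ℕ) (hp : p.Prime)
    (X : Type*) [Fintype X] (hX : Fintype.card X = p)
    (G : Subgroup (Equiv.Perm X))
    (htrans : ∀ x y : X, ∃ g ∈ G, g x = y) :
    (∀ x₁ x₂ y₁ y₂ : X, x₁ ≠ x₂ → y₁ ≠ y₂ →
      ∃ g ∈ G, g x₁ = y₁ ∧ g x₂ = y₂) ∨ IsSolvable G := by
  classical
  have : Fact p.Prime := ⟨hp⟩
  refine or_iff_not_imp_left.2 fun hnot => ?_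
  push Not at hnot
  obtain ⟨x₁, x₂, y₁, y₂, hx, hy, hno⟩ := hnot
  have : MulAction.IsPretransitive G X :=
    ⟨fun x y => by obtain ⟨g, hg, hgx⟩ := htrans x y; exact ⟨⟨g, hg⟩, hgx⟩⟩
  have hdvd : p ∣ Nat.card G := by
    rw [← hX, ← Nat.card_eq_fintype_card, ← MulAction.index_stabilizer_of_transitive G x₁]
    exact Subgroup.index_dvd_card _
  obtain ⟨⟨σ, hσG⟩, hσ⟩ := exists_prime_orderOf_dvd_card' p hdvd
  rw [Subgroup.orderOf_mk] at hσ
  obtain ⟨e, he⟩ := exists_equiv_zmod_of_orderOf hX σ hσ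
  let R : X → X → Prop := fun x y => ∃ g ∈ G, g x₁ = x ∧ g x₂ = y
  have hR : ∀ g ∈ G, ∀ x y, R x y → R (g x) (g y) := by
    rintro g hg x y ⟨k, hk, rfl, rfl⟩
    exact ⟨g * k, G.mul_mem hg hk, rfl, rfl⟩
  have hR' : ∀ g ∈ G, ∀ x y, R x y ↔ R (g x) (g y) := fun g hg x y =>
    ⟨hR g hg x y, fun h => by simpa using hR _ (G.inv_mem hg) _ _ h⟩
  let U : Finset (ZMod p) := Finset.univ.filter fun u => R (e 0) (e u)
  have hU : ∀ i j, i - j ∈ U ↔ R (e j) (e i) := by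
    intro i j
    have h := hR' _ (G.pow_mem hσG j.val) (e 0) (e (i - j))
    rw [← he, ← he, zero_add, sub_add_cancel] at h
    simpa [U] using h
  refine isSolvable_of_forall_affine e G fun g hg => ?_
  suffices haff : ∃ a b, ∀ x, ((e.trans g).trans e.symm) x = a * x + b by
    obtain ⟨a, b, hab⟩ := haff
    exact ⟨a, b, fun x => by rw [← hab]; simp⟩
  refine affine_of_preserves U ?_ ?_ ?_ _ ?_
  · rw [← sub_self (0 : ZMod p), hU]
    rintro ⟨k, -, h₁, h₂⟩
    exact hx (k.injective (h₁.trans h₂.symm))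
  · exact ⟨e.symm x₂ - e.symm x₁, (hU _ _).2 ⟨1, G.one_mem, by simp, by simp⟩⟩
  · refine ⟨e.symm y₂ - e.symm y₁, ?_, ?_⟩
    · rw [sub_ne_zero]
      exact fun h => hy (e.symm.injective h).symm
    · rw [hU]
      rintro ⟨k, hk, h₁, h₂⟩
      exact hno k hk (by simpa using h₁) (by simpa using h₂)
  · intro i j
    rw [hU, hU, hR' g hg]
    simp
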